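/- Let X be a Banach space and A, B : X → X two maps. Suppose A is a contraction (Lipschitz with constant k < 1) and B is completely continuous (continuous and mapping bounded sets to relatively compact sets). Then either the equation w = A(w) + B(w) has a solution w ∈ X, or the set Z = { w ∈ X : w = λ·A(w/λ) + λ·B(w) for some λ ∈ (0,1) } is unbounded. -/

import Mathlib

open Set

theorem det_one_add_smul_eq_sum_lagrange {V : Type*} [NormedAddCommGroup V] [NormedSpace ℝ V]
    [FiniteDimensional ℝ V] (M : V →L[ℝ] V) {v : ℕ → ℝ} (hv : Function.Injective v) (t : ℝ) :
    (1 + t • M).det = ∑ i ∈ Finset.range (Module.finrank ℝ V + 1),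
      (Lagrange.basis (Finset.range (Module.finrank ℝ V + 1)) v i).eval t *
        (1 + v i • M).det := by
  let b := Module.finBasis ℝ V
  let N := LinearMap.toMatrix b b (M : V →ₗ[ℝ] V)
  let p : Polynomial ℝ := ((Polynomial.X : Polynomial ℝ) • N.map Polynomial.C +
    (1 : Matrix _ _ ℝ).map Polynomial.C).det
  have hp : ∀ s : ℝ, p.eval s = (1 + s • M).det := by
    intro s
    have h1 : (1 + s • M).det = (1 + s • N).det := by
      rw [ContinuousLinearMap.det, ← LinearMap.det_toMatrix b]
      congr 1
      simp [N, LinearMap.toMatrix_one]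
    rw [h1, ← Polynomial.coe_evalRingHom, RingHom.map_det]
    congr 1
    ext i j
    by_cases hij : i = j <;> simp [hij] <;> ring
  have hdeg : p.degree < (Finset.range (Module.finrank ℝ V + 1)).card := by
    refine lt_of_le_of_lt (Polynomial.degree_le_of_natDegree_le
      (Polynomial.natDegree_det_X_add_C_le N 1)) ?_
    simp only [Fintype.card_fin, Finset.card_range]
    exact_mod_cast Nat.lt_succ_self _
  rw [← hp t, Lagrange.eq_interpolate hv.injOn hdeg, Lagrange.interpolate_apply,
    Polynomial.eval_finsetSum]
  simp only [Polynomial.eval_mul, Polynomial.eval_C, hp]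
  exact Finset.sum_congr rfl fun i _ => mul_comm _ _

theorem norm_indicator_ball_sub_le {V W : Type*} [NormedAddCommGroup V] [NormedSpace ℝ V]
    [NormedAddCommGroup W] {k : V → W} {R C : ℝ} (hC : 0 ≤ C)
    (hk : ∀ x ∈ Metric.closedBall (0 : V) R, ∀ y ∈ Metric.closedBall (0 : V) R,
      ‖k x - k y‖ ≤ C * ‖x - y‖)
    (hk0 : ∀ x, ‖x‖ = R → k x = 0) (x y : V) :
    ‖(Metric.ball (0 : V) R).indicator k x - (Metric.ball (0 : V) R).indicator k y‖
      ≤ C * ‖x - y‖ := by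
  have key : ∀ x y : V, ‖x‖ < R → R ≤ ‖y‖ → ‖k x‖ ≤ C * ‖x - y‖ := by
    intro x y hx hy
    obtain ⟨c, ⟨hc0, hc1⟩, hc⟩ : R ∈ (fun c : ℝ => ‖x + c • (y - x)‖) '' Icc 0 1 :=
      intermediate_value_Icc zero_le_one (by fun_prop) ⟨by simpa using hx.le, by simpa using hy⟩
    have h := hk x (by simpa using hx.le) (x + c • (y - x)) (by simpa using hc.le)
    rw [hk0 _ hc, sub_zero] at h
    refine h.trans (mul_le_mul_of_nonneg_left ?_ hC)
    rw [sub_add_cancel_left, norm_neg, norm_smul, Real.norm_of_nonneg hc0, norm_sub_rev y x]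
    exact mul_le_of_le_one_left (norm_nonneg _) hc1
  by_cases hx : ‖x‖ < R <;> by_cases hy : ‖y‖ < R
  · rw [indicator_of_mem (by simpa), indicator_of_mem (by simpa)]
    exact hk x (by simpa using hx.le) y (by simpa using hy.le)
  · rw [indicator_of_mem (by simpa), indicator_of_notMem (by simpa using hy), sub_zero]
    exact key x y hx (not_lt.1 hy)
  · rw [indicator_of_notMem (by simpa using hx), indicator_of_mem (by simpa), zero_sub, norm_neg,
      norm_sub_rev]
    exact key y x hy (not_lt.1 hx)
  · rw [indicator_of_notMem (by simpa using hx), indicator_of_notMem (by simpa using hy)]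
    simpa using by positivity

theorem exists_unique_add_eq_of_lipschitz {V : Type*} [NormedAddCommGroup V] [CompleteSpace V]
    {H : V → V} {c : ℝ} (hc : c < 1) (hH : ∀ x y, ‖H x - H y‖ ≤ c * ‖x - y‖) (y : V) :
    ∃! x, x + H x = y := by
  have hcontr : ContractingWith c.toNNReal (fun x => y - H x) := by
    refine ⟨by simpa using hc, LipschitzWith.of_dist_le_mul fun a b => ?_⟩
    rw [dist_eq_norm, dist_eq_norm, sub_sub_sub_cancel_left, norm_sub_rev a b]
    exact (hH b a).trans (mul_le_mul_of_nonneg_right (Real.le_coe_toNNReal c) (norm_nonneg _))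
  have hiff : ∀ x, x + H x = y ↔ Function.IsFixedPt (fun x => y - H x) x := fun x => by
    rw [Function.IsFixedPt, eq_comm, ← sub_eq_iff_eq_add]
  simp only [hiff]
  exact ⟨_, hcontr.fixedPoint_isFixedPt, fun x hx => hcontr.fixedPoint_unique hx⟩

theorem bijOn_ball_add_smul {V : Type*} [NormedAddCommGroup V] [NormedSpace ℝ V] [CompleteSpace V]
    {k : V → V} {R C t : ℝ} (hC : 0 ≤ C)
    (hk : ∀ x ∈ Metric.closedBall (0 : V) R, ∀ y ∈ Metric.closedBall (0 : V) R,
      ‖k x - k y‖ ≤ C * ‖x - y‖)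
    (hk0 : ∀ x, ‖x‖ = R → k x = 0) (hkR : ∀ x, ‖x‖ ≤ R → ‖x + k x‖ ≤ R)
    (ht0 : 0 ≤ t) (ht1 : t < 1) (htC : t * C < 1) :
    BijOn (fun x => x + t • k x) (Metric.ball (0 : V) R) (Metric.ball (0 : V) R) := by
  have hH : ∀ x y, ‖t • (Metric.ball (0 : V) R).indicator k x -
      t • (Metric.ball (0 : V) R).indicator k y‖ ≤ t * C * ‖x - y‖ := fun x y => by
    rw [← smul_sub, norm_smul, Real.norm_of_nonneg ht0, mul_assoc]
    exact mul_le_mul_of_nonneg_left (norm_indicator_ball_sub_le hC hk hk0 x y) ht0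
  have hex := exists_unique_add_eq_of_lipschitz htC hH
  refine ⟨fun x hx => ?_, fun x hx y hy hxy => ?_, fun y hy => ?_⟩
  · rw [mem_ball_zero_iff] at hx ⊢
    calc ‖x + t • k x‖ = ‖(1 - t) • x + t • (x + k x)‖ := by congr 1; module
      _ ≤ (1 - t) * ‖x‖ + t * ‖x + k x‖ := by
        refine (norm_add_le _ _).trans_eq ?_
        rw [norm_smul, norm_smul, Real.norm_of_nonneg ht0, Real.norm_of_nonneg (by linarith)]
      _ < R := by nlinarith [hkR x hx.le]
  · refine (hex (y + t • k y)).unique ?_ ?_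
    · rw [indicator_of_mem hx]; exact hxy
    · rw [indicator_of_mem hy]
  · obtain ⟨x, hx, -⟩ := hex y
    by_cases hxR : x ∈ Metric.ball (0 : V) R
    · exact ⟨x, hxR, by simpa [indicator_of_mem hxR] using hx⟩
    · simp only [indicator_of_notMem hxR, smul_zero, add_zero] at hx
      exact absurd (hx ▸ hy) hxR

section Brouwer

variable {E : Type*} [NormedAddCommGroup E] [InnerProductSpace ℝ E] [FiniteDimensional ℝ E]
  [MeasurableSpace E] [BorelSpace E]

open MeasureTheory

theorem integral_det_one_add_smul_eq_volume_ball {k : E → E} (hk : ContDiff ℝ 1 k) {R : ℝ}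
    (hk0 : ∀ x, ‖x‖ = R → k x = 0) (hkR : ∀ x, ‖x‖ ≤ R → ‖x + k x‖ ≤ R) :
    ∃ t₀ > (0 : ℝ), ∀ t ∈ Ioo 0 t₀,
      ∫ x in Metric.ball (0 : E) R, (1 + t • fderiv ℝ k x).det =
        volume.real (Metric.ball (0 : E) R) := by
  have hcont : Continuous (fderiv ℝ k) := hk.continuous_fderiv one_ne_zero
  obtain ⟨C, hC⟩ := (isCompact_closedBall (0 : E) R).exists_bound_of_continuousOn
    hcont.continuousOn
  have hC1 : 0 < max C 1 := by positivity
  have hdiff : Differentiable ℝ k := hk.differentiable one_ne_zero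
  have hlip : ∀ x ∈ Metric.closedBall (0 : E) R, ∀ y ∈ Metric.closedBall (0 : E) R,
      ‖k x - k y‖ ≤ max C 1 * ‖x - y‖ := fun x hx y hy =>
    (convex_closedBall (0 : E) R).norm_image_sub_le_of_norm_fderiv_le
      (fun z _ => hdiff z) (fun z hz => (hC z hz).trans (le_max_left _ _)) hy hx
  obtain ⟨δ, hδ, hdet⟩ : ∃ δ > 0, ∀ L : E →L[ℝ] E, ‖L‖ < δ → 0 < (1 + L).det := by
    have hc : Continuous fun L : E →L[ℝ] E => (1 + L).det :=
      ContinuousLinearMap.continuous_det.comp (by fun_prop)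
    have h0 : 0 < (1 + (0 : E →L[ℝ] E)).det := by
      simp [ContinuousLinearMap.det]
    obtain ⟨δ, hδ, h⟩ := Metric.eventually_nhds_iff.1 (hc.continuousAt.eventually (lt_mem_nhds h0))
    exact ⟨δ, hδ, fun L hL => h (by simpa using hL)⟩
  refine ⟨min 1 (min 1 δ / max C 1), by positivity, fun t ht => ?_⟩
  have ht1 : t < 1 := ht.2.trans_le (min_le_left _ _)
  have htC : t * max C 1 < min 1 δ := (lt_div_iff₀ hC1).1 (ht.2.trans_le (min_le_right _ _))
  have hbij := bijOn_ball_add_smul hC1.le hlip hk0 hkR ht.1.le ht1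
    (htC.trans_le (min_le_left _ _))
  have hvol := integral_image_eq_integral_abs_det_fderiv_smul (volume : Measure E)
    (f := fun x => x + t • k x) (f' := fun x => 1 + t • fderiv ℝ k x)
    (Metric.isOpen_ball (x := (0 : E)) (ε := R)).measurableSet
    (fun x _ => ((hasFDerivAt_id x).add
      ((hdiff x).hasFDerivAt.const_smul t)).hasFDerivWithinAt) hbij.injOn (fun _ => (1 : ℝ))
  rw [hbij.image_eq] at hvol
  simp only [smul_eq_mul, mul_one, setIntegral_const] at hvol
  rw [hvol]
  refine setIntegral_congr_fun Metric.isOpen_ball.measurableSet fun x hx => ?_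
  refine (abs_of_pos (hdet _ ?_)).symm
  rw [norm_smul, Real.norm_of_nonneg ht.1.le]
  refine lt_of_le_of_lt (mul_le_mul_of_nonneg_left ((hC x (Metric.ball_subset_closedBall hx)).trans
    (le_max_left _ _)) ht.1.le) (htC.trans_le (min_le_right _ _))

theorem integral_det_one_add_fderiv_eq_volume_ball {k : E → E} (hk : ContDiff ℝ 1 k) {R : ℝ}
    (hk0 : ∀ x, ‖x‖ = R → k x = 0) (hkR : ∀ x, ‖x‖ ≤ R → ‖x + k x‖ ≤ R) :
    ∫ x in Metric.ball (0 : E) R, (1 + fderiv ℝ k x).det =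
        volume.real (Metric.ball (0 : E) R) := by
  obtain ⟨t₀, ht₀, h⟩ := integral_det_one_add_smul_eq_volume_ball hk hk0 hkR
  let v : ℕ → ℝ := fun i => t₀ / (i + 2)
  have hv : Function.Injective v := fun i j hij => by
    simpa [v, div_eq_mul_inv, ht₀.ne'] using hij
  have hvmem : ∀ i, v i ∈ Ioo 0 t₀ := fun i =>
    ⟨by positivity, div_lt_self ht₀ (by linarith [(Nat.cast_nonneg i : (0 : ℝ) ≤ i)])⟩
  have hcont : Continuous (fderiv ℝ k) := hk.continuous_fderiv one_ne_zero
  have hint : ∀ t : ℝ, IntegrableOn (fun x => (1 + t • fderiv ℝ k x).det)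
      (Metric.ball (0 : E) R) := fun t =>
    ((ContinuousLinearMap.continuous_det.comp (by fun_prop)).continuousOn.integrableOn_compact
      (isCompact_closedBall (0 : E) R)).mono_set Metric.ball_subset_closedBall
  have hexp := fun x => det_one_add_smul_eq_sum_lagrange (fderiv ℝ k x) hv 1
  simp only [one_smul] at hexp
  simp only [hexp]
  rw [integral_finsetSum _ fun i _ => (hint (v i)).const_mul _]
  simp only [integral_const_mul, h _ (hvmem _)]
  rw [← Finset.sum_mul, ← Polynomial.eval_finsetSum,
    Lagrange.sum_basis hv.injOn Finset.nonempty_range_add_one, Polynomial.eval_one, one_mul]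

theorem not_contDiff_retraction_sphere {f : E → E} (hf : ContDiff ℝ 1 f) {R : ℝ} (hR : 0 < R)
    (hfR : ∀ x, ‖f x‖ = R) : ∃ x, ‖x‖ = R ∧ f x ≠ x := by
  by_contra! hid
  have hI := integral_det_one_add_fderiv_eq_volume_ball (k := fun x => f x - x) (R := R)
    (hf.sub contDiff_id) (fun x hx => by rw [hid x hx, sub_self]) (fun x _ => by simp [hfR])
  have hdf : Differentiable ℝ f := hf.differentiable one_ne_zero
  have hzero : ∀ x, (1 + fderiv ℝ (fun x => f x - x) x).det = 0 := by
    intro x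
    have h1 : 1 + fderiv ℝ (fun x => f x - x) x = fderiv ℝ f x := by
      rw [fderiv_fun_sub (hdf x) differentiableAt_fun_id, fderiv_fun_id]
      exact add_sub_cancel _ _
    rw [h1]
    by_contra hne
    have hsurj : Function.Surjective (fderiv ℝ f x : E →ₗ[ℝ] E) :=
      (LinearMap.equivOfDetNeZero _ hne).surjective
    obtain ⟨w, hw⟩ := hsurj (f x)
    have hconst : HasFDerivAt (fun y => ‖f y‖ ^ 2) (0 : E →L[ℝ] ℝ) x := by
      simp only [hfR]
      exact hasFDerivAt_const _ _
    have h2 := DFunLike.congr_fun ((hdf x).hasFDerivAt.norm_sq.unique hconst) w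
    have hw' : fderiv ℝ f x w = f x := hw
    simp [hw', hfR, hR.ne'] at h2
  simp only [hzero, integral_zero] at hI
  have := Metric.measure_ball_pos volume (0 : E) hR
  exact (ENNReal.toReal_pos this.ne' measure_ball_lt_top.ne).ne hI

theorem exists_fixedPoint_of_contDiff {P : E → E} (hP : ContDiff ℝ 1 P) {R : ℝ} (hR : 0 < R)
    (hPR : ∀ x, R ≤ ‖x‖ → P x = 0) : ∃ x, P x = x := by
  by_contra! hne
  have hne' : ∀ x, x - P x ≠ 0 := fun x => sub_ne_zero.2 (hne x).symm
  have hsub : ContDiff ℝ 1 fun x => x - P x := contDiff_id.sub hP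
  obtain ⟨x, hx, hfx⟩ := not_contDiff_retraction_sphere (hR := hR)
    (f := fun x => (R * ‖x - P x‖⁻¹) • (x - P x))
    ((contDiff_const.mul ((hsub.norm ℝ hne').inv fun x => norm_ne_zero_iff.2 (hne' x))).smul hsub)
    (fun x => by
      have := norm_ne_zero_iff.2 (hne' x)
      rw [norm_smul, Real.norm_of_nonneg (by positivity), mul_assoc, inv_mul_cancel₀ this, mul_one])
  refine hfx ?_
  simp [hPR x hx.ge, hx, hR.ne']

end Brouwer

theorem exists_fixedPoint_of_continuous_of_bounded {E : Type*} [NormedAddCommGroup E]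
    [InnerProductSpace ℝ E] [FiniteDimensional ℝ E] {F : E → E} (hF : Continuous F) {R : ℝ}
    (hFR : ∀ x, ‖F x‖ ≤ R) : ∃ x, F x = x := by
  borelize E
  have hR : 0 ≤ R := (norm_nonneg _).trans (hFR 0)
  by_contra! hne
  obtain ⟨x₀, -, hx₀⟩ := (isCompact_closedBall (0 : E) (R + 1)).exists_isMinOn
    ⟨0, by simpa using by linarith⟩ (f := fun x => ‖F x - x‖) (by fun_prop)
  have hpos : 0 < ‖F x₀ - x₀‖ := norm_pos_iff.2 (sub_ne_zero.2 (hne x₀))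
  let χ : E → ℝ := fun x => max 0 (min 1 (R + 2 - ‖x‖))
  have hχ : ∀ x, |χ x| ≤ 1 := fun x => by
    rw [abs_of_nonneg (le_max_left _ _)]
    exact max_le zero_le_one (min_le_left _ _)
  obtain ⟨P, hP, hPf, hsupp⟩ := Continuous.exists_contDiff_approx (f := fun x => χ x • F x) 1
    (by fun_prop) (continuous_const (y := min 1 ‖F x₀ - x₀‖)) (fun _ => by positivity)
  obtain ⟨x, hx⟩ := exists_fixedPoint_of_contDiff (mod_cast hP) (R := R + 2) (by linarith)
    fun x hx => by
      by_contra h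
      refine hsupp h ?_
      have : χ x = 0 := max_eq_left ((min_le_right _ _).trans (by linarith))
      simp [this]
  have hxf := hPf x
  rw [hx, dist_eq_norm] at hxf
  have hxR : ‖x‖ ≤ R + 1 := by
    have h1 : ‖χ x • F x‖ ≤ R := by
      rw [norm_smul, Real.norm_eq_abs]
      exact (mul_le_of_le_one_left (norm_nonneg _) (hχ x)).trans (hFR x)
    linarith [norm_le_norm_add_norm_sub' x (χ x • F x), min_le_left 1 ‖F x₀ - x₀‖]
  have hχx : χ x = 1 := by
    simp only [χ]
    rw [min_eq_left (by linarith), max_eq_right zero_le_one]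
  rw [hχx, one_smul, norm_sub_rev] at hxf
  have hmin : ‖F x₀ - x₀‖ ≤ ‖F x - x‖ := hx₀ (by simpa using hxR)
  exact absurd hxf (not_lt.2 ((min_le_right _ _).trans hmin))

section Schauder

variable {X : Type*} [NormedAddCommGroup X] [NormedSpace ℝ X]

theorem exists_norm_sub_le_of_mapsTo_compact {G : X → X} (hG : Continuous G) {K : Set X}
    (hK : IsCompact K) (hGK : ∀ x, G x ∈ K) {ε : ℝ} (hε : 0 < ε) : ∃ x, ‖x - G x‖ ≤ ε := by
  obtain ⟨T, -, hTfin, hKT⟩ := hK.finite_cover_balls hε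
  have : Fintype T := hTfin.fintype
  let φ : T → X → ℝ := fun i x => max 0 (ε - ‖(i : X) - x‖)
  have hφ : ∀ i, Continuous (φ i) := fun i => by fun_prop
  have hφ0 : ∀ i x, 0 ≤ φ i x := fun i x => le_max_left _ _
  have hS : ∀ x ∈ K, 0 < ∑ i, φ i x := fun x hx => by
    obtain ⟨i, hi, hxi⟩ := mem_iUnion₂.1 (hKT hx)
    refine Finset.sum_pos' (fun i _ => hφ0 i x) ⟨⟨i, hi⟩, Finset.mem_univ _, ?_⟩
    rw [Metric.mem_ball, dist_eq_norm, norm_sub_rev] at hxi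
    exact lt_max_of_lt_right (sub_pos.2 hxi)
  let c : X → EuclideanSpace ℝ T := fun x => WithLp.toLp 2 fun i => φ i x / ∑ j, φ j x
  have hc : ContinuousOn c K := by
    refine (PiLp.continuous_toLp 2 _).comp_continuousOn (continuousOn_pi.2 fun i => ?_)
    exact (hφ i).continuousOn.div (by fun_prop) fun x hx => (hS x hx).ne'
  let p : EuclideanSpace ℝ T → X := fun a => ∑ i, a i • (i : X)
  have hp : Continuous p := by fun_prop
  obtain ⟨R, hR⟩ := hK.exists_bound_of_continuousOn hc
  obtain ⟨a, ha⟩ := exists_fixedPoint_of_continuous_of_bounded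
    (hc.comp_continuous (hG.comp hp) fun a => hGK (p a)) fun a => hR _ (hGK (p a))
  refine ⟨p a, ?_⟩
  set y := G (p a) with hy
  have hai : ∀ i, a i = φ i y / ∑ j, φ j y := fun i => by
    conv_lhs => rw [← ha]
    rfl
  have ha0 : ∀ i, 0 ≤ a i := fun i => by
    rw [hai]
    exact div_nonneg (hφ0 i y) (hS y (hGK _)).le
  have hsum : ∑ i, a i = 1 := by
    simp only [hai]
    rw [← Finset.sum_div, div_self (hS y (hGK _)).ne']
  calc ‖p a - y‖ = ‖∑ i, a i • ((i : X) - y)‖ := by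
        simp only [smul_sub, Finset.sum_sub_distrib, ← Finset.sum_smul, hsum, one_smul, p]
    _ ≤ ∑ i, a i * ε := norm_sum_le_of_le _ fun i _ => by
        rw [norm_smul, Real.norm_of_nonneg (ha0 i)]
        rcases le_or_gt ‖(i : X) - y‖ ε with h | h
        · exact mul_le_mul_of_nonneg_left h (ha0 i)
        · have : φ i y = 0 := max_eq_left (by linarith)
          simp [hai, this]
    _ = ε := by rw [← Finset.sum_mul, hsum, one_mul]

/-- **Schauder fixed point theorem** for a continuous self-map of a normed space whose range lies
in a compact set. -/
theorem exists_fixedPoint_of_mapsTo_compact {G : X → X} (hG : Continuous G) {K : Set X}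
    (hK : IsCompact K) (hGK : ∀ x, G x ∈ K) : ∃ x, G x = x := by
  choose x hx using fun n : ℕ => exists_norm_sub_le_of_mapsTo_compact hG hK hGK
    (Nat.one_div_pos_of_nat (α := ℝ) (n := n))
  obtain ⟨y, -, φ, hφ, hy⟩ := hK.tendsto_subseq fun n => hGK (x n)
  have hsub : Filter.Tendsto (fun n => x n - G (x n)) Filter.atTop (nhds 0) :=
    squeeze_zero_norm hx tendsto_one_div_add_atTop_nhds_zero_nat
  have hxy : Filter.Tendsto (x ∘ φ) Filter.atTop (nhds y) := by
    simpa [Function.comp_def] using (hsub.comp hφ.tendsto_atTop).add hy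
  exact ⟨y, tendsto_nhds_unique ((hG.tendsto y).comp hxy) hy⟩

end Schauder

theorem exists_continuous_rightInverse_id_sub {X : Type*} [NormedAddCommGroup X] [CompleteSpace X]
    {A : X → X} {k : ℝ} (hk1 : k < 1) (hA : ∀ x y : X, ‖A x - A y‖ ≤ k * ‖x - y‖) :
    ∃ S : X → X, Continuous S ∧ ∀ y, S y = A (S y) + y := by
  have hneg : ∀ x y, ‖-A x - -A y‖ ≤ k * ‖x - y‖ := fun x y => by
    rw [neg_sub_neg, norm_sub_rev]
    exact hA x y
  choose S hS _ using exists_unique_add_eq_of_lipschitz hk1 hneg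
  have hS' : ∀ y, S y = A (S y) + y := fun y =>
    (add_neg_eq_iff_eq_add.1 (hS y)).trans (add_comm _ _)
  refine ⟨S, (LipschitzWith.of_dist_le' (K := (1 - k)⁻¹) fun y z => ?_).continuous, hS'⟩
  rw [dist_eq_norm, dist_eq_norm, inv_mul_eq_div, le_div_iff₀ (by linarith)]
  have h : ‖S y - S z‖ ≤ ‖A (S y) - A (S z)‖ + ‖y - z‖ := by
    conv_lhs => rw [hS' y, hS' z, add_sub_add_comm]
    exact norm_add_le _ _
  linarith [hA (S y) (S z)]

theorem burton_kirk
    (X : Type*) [NormedAddCommGroup X] [NormedSpace ℝ X] [CompleteSpace X]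
    (A B : X → X) (k : ℝ) (hk0 : 0 ≤ k) (hk1 : k < 1)
    (hA : ∀ x y : X, ‖A x - A y‖ ≤ k * ‖x - y‖)
    (hB_cont : Continuous B)
    (hB_compact : ∀ s : Set X, Bornology.IsBounded s → IsCompact (closure (B '' s))) :
    (∃ w : X, w = A w + B w) ∨
      ¬ Bornology.IsBounded
        {w : X | ∃ lam : ℝ, lam ∈ Set.Ioo (0:ℝ) 1 ∧ w = lam • A (lam⁻¹ • w) + lam • B w} := by
  rw [or_iff_not_imp_right, not_not]
  intro hZ
  obtain ⟨R, hR, hZR⟩ := hZ.exists_pos_norm_lt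
  obtain ⟨S, hS_cont, hS⟩ := exists_continuous_rightInverse_id_sub hk1 hA
  let r : X → X := fun x => (R / max R ‖x‖) • x
  have hmax : ∀ x : X, 0 < max R ‖x‖ := fun x => lt_max_of_lt_left hR
  have hr_cont : Continuous r :=
    (continuous_const.div (by fun_prop) fun x => (hmax x).ne').smul continuous_id
  have hr_mem : ∀ x, r x ∈ Metric.closedBall (0 : X) R := fun x => by
    rw [mem_closedBall_zero_iff, norm_smul, Real.norm_of_nonneg (by positivity),
      div_mul_eq_mul_div, div_le_iff₀ (hmax x)]
    exact mul_le_mul_of_nonneg_left (le_max_right _ _) hR.le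
  obtain ⟨y, hy⟩ := exists_fixedPoint_of_mapsTo_compact
    (hS_cont.comp (hB_cont.comp hr_cont))
    ((hB_compact _ Metric.isBounded_closedBall).image hS_cont)
    fun x => mem_image_of_mem S (subset_closure (mem_image_of_mem B (hr_mem x)))
  have hyA : y = A y + B (r y) := by
    have h := hS (B (r y))
    rwa [show S (B (r y)) = y from hy] at h
  rcases le_or_gt ‖y‖ R with hyR | hyR
  · have hry : r y = y := by simp [r, max_eq_left hyR, hR.ne']
    exact ⟨y, by rwa [hry] at hyA⟩
  · have hy0 : 0 < ‖y‖ := hR.trans hyR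
    have hry : r y = (R / ‖y‖) • y := by simp [r, max_eq_right hyR.le]
    have hlt := hZR (r y) ⟨R / ‖y‖, ⟨by positivity, (div_lt_one hy0).2 hyR⟩, by
      rw [← smul_add]
      conv_rhs => rw [hry, inv_smul_smul₀ (by positivity), ← hry, ← hyA]
      exact hry⟩
    rw [hry, norm_smul, Real.norm_of_nonneg (by positivity), div_mul_cancel₀ _ hy0.ne'] at hlt
    exact absurd hlt (lt_irrefl R)
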